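/- (Ellipticity estimate, upper bound) Let γ ∈ [-3,-2] and set p = γ(γ+2)/(γ+5) − γ. For every G, M > 0 there exists Λ > 0 depending on γ, G and M such that for every probability density f on ℝ³ with ‖f‖_{L^∞} ≤ G and ∫ ⟨v⟩^p f ≤ M, the symmetric matrix ā(v) := ∫ a(v−w) f(w) dw satisfies, for every v ∈ ℝ³ and every unit vector ξ ∈ ℝ³: ⟨ā(v) ξ, ξ⟩ ≤ Λ ⟨v⟩^{γ+2}, and moreover, if ξ is parallel to v, ⟨ā(v) ξ, ξ⟩ ≤ Λ ⟨v⟩^γ. -/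

import Mathlib

noncomputable section

open MeasureTheory Real
open scoped ENNReal RealInnerProductSpace

/-- The velocity space ℝ³. -/
abbrev V3 : Type := EuclideanSpace ℝ (Fin 3)

/-- 3×3 real matrices. -/
abbrev Mat3 : Type := Matrix (Fin 3) (Fin 3) ℝ

/-- Japanese bracket ⟨v⟩ = √(1+|v|²). -/
def jap (v : V3) : ℝ := Real.sqrt (1 + ‖v‖ ^ 2)

/-- `i`-th basis vector of ℝ³. -/
def esingle (i : Fin 3) : V3 := EuclideanSpace.single i (1 : ℝ)

/-- Orthogonal projection Π(z) onto z^⊥. -/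
def proj (z : V3) : Mat3 := fun i j =>
  (if i = j then (1 : ℝ) else 0) - (z i / ‖z‖) * (z j / ‖z‖)

/-- Landau kernel a(z) = |z|^{γ+2} Π(z). -/
def landauKernel (γ : ℝ) (z : V3) : Mat3 := fun i j => ‖z‖ ^ (γ + 2) * proj z i j

/-- Cut-off kernel ã(z) = ⟨z⟩^γ |z|² Π(z). -/
def cutoffKernel (γ : ℝ) (z : V3) : Mat3 := fun i j => jap z ^ γ * ‖z‖ ^ 2 * proj z i j

/-- Bilinear form ⟨A w, z⟩. -/
def bilin (A : Mat3) (w z : V3) : ℝ := ∑ i, ∑ j, A i j * w i * z j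

/-- Quadratic form A : w^{⊗2}. -/
def quadForm (A : Mat3) (w : V3) : ℝ := bilin A w w

/-- Matrix dot product A : B. -/
def matDot (A B : Mat3) : ℝ := ∑ i, ∑ j, A i j * B i j

/-- (Frobenius) norm of a 3×3 matrix. -/
def matNorm (A : Mat3) : ℝ := Real.sqrt (∑ i, ∑ j, (A i j) ^ 2)

/-- Entropy H(f) = ∫ f ln f. -/
def entropy (f : V3 → ℝ) : ℝ := ∫ v, f v * Real.log (f v)

/-- Relative entropy H(f|g) = ∫ ((f/g) ln(f/g) − f/g + 1) g ∈ [0,∞]. -/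
def relEntropy (f g : V3 → ℝ) : ℝ≥0∞ :=
  ∫⁻ v, ENNReal.ofReal ((f v / g v * Real.log (f v / g v) - f v / g v + 1) * g v)

/-- Hessian matrix of a function on ℝ³. -/
def hess (φ : V3 → ℝ) (v : V3) : Mat3 := fun i j =>
  iteratedFDeriv ℝ 2 φ v ![esingle i, esingle j]

/-- Hessian matrix within a set. -/
def hessW (φ : V3 → ℝ) (s : Set V3) (v : V3) : Mat3 := fun i j =>
  iteratedFDerivWithin ℝ 2 φ s v ![esingle i, esingle j]

/-- Gradient of the logarithm, ∇ ln φ. -/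
def logGrad (φ : V3 → ℝ) (v : V3) : V3 := gradient (fun w => Real.log (φ w)) v

/-- Hessian of the logarithm, ∇² ln φ. -/
def logHess (φ : V3 → ℝ) (v : V3) : Mat3 := hess (fun w => Real.log (φ w)) v

/-- `G` is the weak gradient of `F` on ℝ⁶ ≃ ℝ³ × ℝ³. -/
def IsWeakGrad6 (F : V3 × V3 → ℝ) (G : V3 × V3 → V3 × V3) : Prop :=
  ∀ φ : V3 × V3 → ℝ, ContDiff ℝ (⊤ : ℕ∞) φ → HasCompactSupport φ →
    ∀ e : V3 × V3,
      (∫ p : V3 × V3, F p * fderiv ℝ φ p e) =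
        - ∫ p : V3 × V3, (⟪(G p).1, e.1⟫ + ⟪(G p).2, e.2⟫) * φ p

/-- `G` is the weak gradient of `F` on ℝ³. -/
def IsWeakGrad3 (F : V3 → ℝ) (G : V3 → V3) : Prop :=
  ∀ φ : V3 → ℝ, ContDiff ℝ (⊤ : ℕ∞) φ → HasCompactSupport φ →
    ∀ e : V3, (∫ v, F v * fderiv ℝ φ v e) = - ∫ v, ⟪G v, e⟫ * φ v

/-- Entropy production functional associated with a weak gradient of √(f f'). -/
def dissipation (γ : ℝ) (G : V3 × V3 → V3 × V3) : ℝ≥0∞ :=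
  ∫⁻ p : V3 × V3,
    ENNReal.ofReal (quadForm (landauKernel γ (p.1 - p.2)) ((G p).1 - (G p).2))

/-- Villani's H-solutions of the Landau equation on [0,T], with weak gradient data
`fGrad s` for √(f_s f_s'). -/
structure IsHSolution (γ T : ℝ) (f : ℝ → V3 → ℝ) (fGrad : ℝ → V3 × V3 → V3 × V3) : Prop where
  nonneg : ∀ t ∈ Set.Icc 0 T, ∀ v, 0 ≤ f t v
  integrable : ∀ t ∈ Set.Icc 0 T, Integrable (f t)
  entIntegrable : ∀ t ∈ Set.Icc 0 T, Integrable (fun v => f t v * Real.log (f t v))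
  contDistrib : ∀ φ : V3 → ℝ, ContDiff ℝ (⊤ : ℕ∞) φ → HasCompactSupport φ →
    ContinuousOn (fun t => ∫ v, φ v * f t v) (Set.Icc 0 T)
  mass : ∀ t ∈ Set.Icc 0 T, (∫ v, f t v) = 1
  momentumIntegrable : ∀ t ∈ Set.Icc 0 T, Integrable (fun v => f t v • v)
  momentum : ∀ t ∈ Set.Icc 0 T, (∫ v, f t v • v) = ∫ v, f 0 v • v
  energyIntegrable : ∀ t ∈ Set.Icc 0 T, Integrable (fun v => ‖v‖ ^ 2 * f t v)
  energy : ∀ t ∈ Set.Icc 0 T, (∫ v, ‖v‖ ^ 2 * f t v) = ∫ v, ‖v‖ ^ 2 * f 0 v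
  weakGrad : ∀ᵐ s ∂(volume.restrict (Set.Icc 0 T)),
    IsWeakGrad6 (fun p => Real.sqrt (f s p.1 * f s p.2)) (fGrad s)
  dissipationFinite : ∀ t ∈ Set.Icc 0 T,
    (∫⁻ s in Set.Ioc (0 : ℝ) t, dissipation γ (fGrad s)) < ⊤
  entropyProd : ∀ t ∈ Set.Icc 0 T,
    entropy (f t) + 2 * (∫⁻ s in Set.Ioc (0 : ℝ) t, dissipation γ (fGrad s)).toReal ≤
      entropy (f 0)
  weakForm : ∀ φ : ℝ → V3 → ℝ,
    ContDiff ℝ 2 (fun q : ℝ × V3 => φ q.1 q.2) →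
    HasCompactSupport (fun q : ℝ × V3 => φ q.1 q.2) →
    ∀ t ∈ Set.Icc 0 T,
      (∫ v, φ t v * f t v) - (∫ v, φ 0 v * f 0 v) =
        (∫ s in (0 : ℝ)..t, ∫ v, deriv (fun r => φ r v) s * f s v) -
          ∫ s in (0 : ℝ)..t, ∫ p : V3 × V3,
            bilin (landauKernel γ (p.1 - p.2))
              (gradient (φ s) p.1 - gradient (φ s) p.2)
              ((fGrad s p).1 - (fGrad s p).2) * Real.sqrt (f s p.1 * f s p.2)

/-- Convolved Landau matrix ā = a ⋆ f. -/
def abar (γ : ℝ) (f : V3 → ℝ) (v : V3) : Mat3 := fun i j =>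
  ∫ w, landauKernel γ (v - w) i j * f w

/-- Zero order coefficient c̄ of the Landau equation in nondivergence form. -/
def cbar (γ : ℝ) (f : V3 → ℝ) (v : V3) : ℝ :=
  if γ = -3 then 8 * Real.pi * f v else 2 * (γ + 3) * ∫ w, ‖v - w‖ ^ γ * f w

/-- Convolution of the cut-off kernel with a density. -/
def cutoffConv (γ : ℝ) (f : V3 → ℝ) (v : V3) : Mat3 := fun i j =>
  ∫ w, cutoffKernel γ (v - w) i j * f w

/-- Classical solution of the Landau equation on a time set `I`
(in nondivergence parabolic form ∂_t g = ā : ∇²g + c̄ g). -/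
structure IsClassicalSolution (γ : ℝ) (I : Set ℝ) (g : ℝ → V3 → ℝ) : Prop where
  pos : ∀ t ∈ I, ∀ v, 0 < g t v
  timeC1 : ∀ v, ContDiffOn ℝ 1 (fun t => g t v) I
  velC2 : ∀ t ∈ I, ContDiff ℝ 2 (g t)
  eqn : ∀ t ∈ I, ∀ v,
    derivWithin (fun s => g s v) I t =
      matDot (abar γ (g t) v) (hess (g t) v) + cbar γ (g t) v * g t v

/-- The moment exponent ρ = max(2κ, 2κ+2γ+4, 2ζ, ν). -/
def rhoExp (γ κ ζ ν : ℝ) : ℝ := max (max (2 * κ) (2 * κ + 2 * γ + 4)) (max (2 * ζ) ν)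

/-- Setting (⋆) of the paper. -/
structure Setting (γ T : ℝ) where
  f : ℝ → V3 → ℝ
  fGrad : ℝ → V3 × V3 → V3 × V3
  g : ℝ → V3 → ℝ
  κ : ℝ
  ν : ℝ
  ζ : ℝ
  K1 : ℝ → ℝ
  K2 : ℝ → ℝ
  K3 : ℝ → ℝ
  Mf : ℝ
  Mg : ℝ
  hγ : γ ∈ Set.Ico (-3 : ℝ) 0
  hT : 0 < T
  hf : IsHSolution γ T f fGrad
  hg : IsClassicalSolution γ (Set.Icc 0 T) g
  hκ : 1 ≤ κ
  hν : 1 ≤ ν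
  hζ : 0 ≤ ζ
  K1nonneg : ∀ t, 0 ≤ K1 t
  K2nonneg : ∀ t, 0 ≤ K2 t
  K3nonneg : ∀ t, 0 ≤ K3 t
  K1meas : Measurable K1
  K2meas : Measurable K2
  K3meas : Measurable K3
  K1bound : ∀ t ∈ Set.Icc 0 T, ∀ v, ‖logGrad (g t) v‖ ≤ K1 t * jap v ^ κ
  K2bound : ∀ t ∈ Set.Icc 0 T, ∀ v,
    |derivWithin (fun s => Real.log (g s v)) (Set.Icc 0 T) t| ≤ K2 t * jap v ^ ν
  K3bound : ∀ t ∈ Set.Icc 0 T, ∀ v, matNorm (logHess (g t) v) ≤ K3 t * jap v ^ ζ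
  Kint : IntegrableOn (fun t => K2 t + K1 t ^ 2 + K3 t ^ 2) (Set.Icc 0 T)
  fMomentInt : ∀ t ∈ Set.Icc 0 T,
    Integrable (fun v => jap v ^ (rhoExp γ κ ζ ν - γ) * f t v)
  fMoment : ∀ t ∈ Set.Icc 0 T, (∫ v, jap v ^ (rhoExp γ κ ζ ν - γ) * f t v) ≤ Mf
  gMomentInt : ∀ t ∈ Set.Icc 0 T,
    Integrable (fun v => jap v ^ (rhoExp γ κ ζ ν - γ) * g t v)
  gMoment : ∀ t ∈ Set.Icc 0 T, (∫ v, jap v ^ (rhoExp γ κ ζ ν - γ) * g t v) ≤ Mg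

/-- The good term 𝒢_s. -/
def goodTerm (γ : ℝ) (f g : ℝ → V3 → ℝ) (fGrad : ℝ → V3 × V3 → V3 × V3) (s : ℝ) : ℝ :=
  2 * ∫ p : V3 × V3,
    quadForm (landauKernel γ (p.1 - p.2))
      (((fGrad s p).1 - (fGrad s p).2) -
        Real.sqrt (f s p.1 * f s p.2) • (logGrad (g s) p.1 - logGrad (g s) p.2))

/-- The vector field a(v−v')(∇−∇')(g g'). -/
def landauFlux (γ : ℝ) (g : V3 → ℝ) (v w : V3) : Fin 3 → ℝ := fun i =>
  ∑ j, landauKernel γ (v - w) i j * (g w * (gradient g v) j - g v * (gradient g w) j)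

/-- (∇−∇')·[a(v−v')(∇−∇')(g g')]. -/
def divDiffFlux (γ : ℝ) (g : V3 → ℝ) (v w : V3) : ℝ :=
  ∑ i, (fderiv ℝ (fun z => landauFlux γ g z w i) v (esingle i) -
        fderiv ℝ (fun z => landauFlux γ g v z i) w (esingle i))

/-- The bad term ℬ_s. -/
def badTerm (γ : ℝ) (f g : ℝ → V3 → ℝ) (s : ℝ) : ℝ :=
  (1 / 2) * ∫ p : V3 × V3,
    (f s p.1 - g s p.1) * (f s p.2 - g s p.2) / (g s p.1 * g s p.2) *
      divDiffFlux γ (g s) p.1 p.2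

/-- Weighted relative Fisher information ∫ |2∇√f − √f ∇ln g|² ⟨v⟩^γ dv. -/
def relFisher (γ : ℝ) (f g : V3 → ℝ) (fGrad3 : V3 → V3) : ℝ :=
  ∫ v, ‖(2 : ℝ) • fGrad3 v - Real.sqrt (f v) • logGrad g v‖ ^ 2 * jap v ^ γ

/-- ‖⟨v⟩^{−κ} ∇ ln g_s‖_{L^∞(ℝ³)} ∈ [0,∞]. -/
def gradLogSup (g : ℝ → V3 → ℝ) (κ s : ℝ) : ℝ≥0∞ :=
  ⨆ v : V3, ENNReal.ofReal (jap v ^ (-κ) * ‖logGrad (g s) v‖)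

/-- ‖⟨v⟩^{−ν} ∂_s ln g_s‖_{L^∞(ℝ³)} ∈ [0,∞]. -/
def dtLogSup (g : ℝ → V3 → ℝ) (T ν s : ℝ) : ℝ≥0∞ :=
  ⨆ v : V3, ENNReal.ofReal
    (jap v ^ (-ν) * |derivWithin (fun r => Real.log (g r v)) (Set.Icc 0 T) s|)

/-- ‖⟨v⟩^{−ζ} ∇² ln g_s‖_{L^∞(ℝ³)} ∈ [0,∞]. -/
def hessLogSup (g : ℝ → V3 → ℝ) (ζ s : ℝ) : ℝ≥0∞ :=
  ⨆ v : V3, ENNReal.ofReal (jap v ^ (-ζ) * matNorm (logHess (g s) v))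

/-- Open cube Σ_R(v₀) = v₀ + (−R,R)³. -/
def cube (v₀ : V3) (R : ℝ) : Set V3 := {v | ∀ i, |v i - v₀ i| < R}

/-- Closed cube v₀ + [−R,R]³ centered at the origin. -/
def ccube (R : ℝ) : Set V3 := {v | ∀ i, |v i| ≤ R}

/-- Distance to the boundary of the cube Σ_R(v₀). -/
def dCube (v₀ : V3) (R : ℝ) (v : V3) : ℝ :=
  Finset.univ.inf' (Finset.univ_nonempty) fun i : Fin 3 => R - |v i - v₀ i|

/-- The moment exponent k(γ,ℓ,δ) of Theorem 2. -/
def kExp (γ ℓ δ : ℝ) : ℝ := 8 * (max (2 + (ℓ - 2) / (2 + δ)) 1 + (2 - γ) / (2 * δ)) - γ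

/-- Truncated power. -/
def g0 (e : ℝ) : V3 → ℝ := (Metric.ball (0 : V3) 1).indicator (fun z => ‖z‖ ^ e)

lemma g0_nonneg (e : ℝ) (z : V3) : 0 ≤ g0 e z :=
  Set.indicator_nonneg (fun _ _ => Real.rpow_nonneg (norm_nonneg _) _) _

lemma g0_integrable (e : ℝ) (he : -1 ≤ e) : Integrable (g0 e) := by
  unfold g0
  rw [integrable_indicator_iff Metric.isOpen_ball.measurableSet]
  refine integrableOn_ball_of_norm_le_rpow (C := 1) (α := -e) ?_ ?_ ?_ ?_
  · simp
  · simp; linarith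
  · refine Filter.Eventually.of_forall fun x => ?_
    rw [neg_neg, one_mul, Real.norm_of_nonneg (Real.rpow_nonneg (norm_nonneg _) _)]
  · exact (measurable_norm.pow_const e).aestronglyMeasurable

lemma near_integrable (e : ℝ) (he : -1 ≤ e) (v : V3) (r : ℝ) (hr : 0 < r) :
    Integrable (fun w : V3 => g0 e (r⁻¹ • (v - w))) :=
  (((integrable_comp_smul_iff volume (g0 e) (inv_pos.2 hr).ne').2
    (g0_integrable e he))).comp_sub_left v

lemma near_integral (e : ℝ) (v : V3) (r : ℝ) (hr : 0 < r) :
    ∫ w : V3, g0 e (r⁻¹ • (v - w)) = r ^ 3 * ∫ z, g0 e z := by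
  rw [integral_sub_left_eq_self (fun z => g0 e (r⁻¹ • z)) volume v,
    Measure.integral_comp_inv_smul_of_nonneg volume (g0 e) hr.le]
  simp

lemma near_eq (e : ℝ) (z : V3) (r : ℝ) (hr : 0 < r) (hz : ‖z‖ < r) :
    ‖z‖ ^ e = r ^ e * g0 e (r⁻¹ • z) := by
  have h1 : ‖r⁻¹ • z‖ = r⁻¹ * ‖z‖ := by
    rw [norm_smul, Real.norm_of_nonneg (inv_pos.2 hr).le]
  have h2 : r⁻¹ • z ∈ Metric.ball (0 : V3) 1 := by
    rw [mem_ball_zero_iff, h1, inv_mul_lt_iff₀ hr]; simpa using hz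
  rw [g0, Set.indicator_of_mem h2, h1, ← Real.mul_rpow hr.le (by positivity)]
  congr 1
  field_simp

lemma quad_landau (γ : ℝ) (z ξ : V3) :
    quadForm (landauKernel γ z) ξ = ‖z‖ ^ (γ + 2) * (‖ξ‖ ^ 2 - (⟪z, ξ⟫ / ‖z‖) ^ 2) := by
  have h1 : ‖ξ‖ ^ 2 = ξ 0 ^ 2 + ξ 1 ^ 2 + ξ 2 ^ 2 := by
    rw [EuclideanSpace.norm_sq_eq]; simp [Fin.sum_univ_three]
  have h2 : ⟪z, ξ⟫ = z 0 * ξ 0 + z 1 * ξ 1 + z 2 * ξ 2 := by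
    rw [PiLp.inner_apply]; simp [Fin.sum_univ_three]; ring
  rw [h1, h2]
  simp only [quadForm, bilin, landauKernel, proj, Fin.sum_univ_three]
  simp
  ring

lemma quad_landau_le (γ : ℝ) (z ξ : V3) :
    quadForm (landauKernel γ z) ξ ≤ ‖z‖ ^ (γ + 2) * ‖ξ‖ ^ 2 := by
  rw [quad_landau]
  have := Real.rpow_nonneg (norm_nonneg z) (γ + 2)
  gcongr
  nlinarith [sq_nonneg (⟪z, ξ⟫ / ‖z‖)]

lemma quad_landau_shift (γ : ℝ) (z w : V3) :
    quadForm (landauKernel γ z) (z + w) ≤ ‖z‖ ^ (γ + 2) * ‖w‖ ^ 2 := by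
  refine le_trans (le_of_eq ?_) (quad_landau_le γ z w)
  rw [quad_landau, quad_landau]
  congr 1
  rcases eq_or_ne z 0 with rfl | hz
  · simp
  have hz' : ‖z‖ ≠ 0 := norm_ne_zero_iff.2 hz
  rw [inner_add_right, real_inner_self_eq_norm_sq, norm_add_sq_real]
  field_simp
  ring

lemma quad_smul (A : Mat3) (c : ℝ) (ξ : V3) : quadForm A (c • ξ) = c ^ 2 * quadForm A ξ := by
  simp only [quadForm, bilin, Finset.mul_sum]
  refine Finset.sum_congr rfl fun i _ => Finset.sum_congr rfl fun j _ => ?_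
  simp
  ring

lemma one_le_jap (v : V3) : 1 ≤ jap v := by
  unfold jap
  rw [Real.one_le_sqrt]; nlinarith [sq_nonneg ‖v‖]

lemma jap_sq (v : V3) : jap v ^ 2 = 1 + ‖v‖ ^ 2 := Real.sq_sqrt (by positivity)

lemma norm_le_jap (v : V3) : ‖v‖ ≤ jap v := by
  unfold jap
  exact Real.le_sqrt_of_sq_le (by linarith)

lemma jap_le (v w : V3) : jap v ≤ jap w + ‖v - w‖ := by
  have h1 := one_le_jap w
  have h3 := jap_sq w
  have h4 := norm_le_jap w
  have h5 : ‖v‖ ≤ ‖w‖ + ‖v - w‖ := by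
    have := norm_add_le w (v - w); simpa using this
  have h6 := norm_nonneg (v - w)
  have h7 := norm_nonneg v
  have h8 := norm_nonneg w
  refine Real.sqrt_le_iff.2 ⟨by positivity, ?_⟩
  nlinarith [mul_le_mul_of_nonneg_right h4 h6, pow_le_pow_left₀ h7 h5 2]

lemma jap_cont : Continuous jap := by unfold jap; fun_prop

/-- pointwise bound on powers -/
lemma pow_bound (e p G : ℝ) (he0 : e ≤ 0) (he1 : -1 ≤ e) (hp : 0 ≤ p) (v w : V3) (φ : ℝ)
    (hφ : 0 ≤ φ) (hφG : φ ≤ G) (r : ℝ) (hr : 0 < r) :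
    ‖v - w‖ ^ e * φ ≤ G * r ^ e * g0 e (r⁻¹ • (v - w))
      + r ^ e * 2 ^ p * jap v ^ (-p) * (jap w ^ p * φ)
      ∨ ‖v - w‖ ^ e ≤ 2 * jap v ^ e := by
  have hJ := one_le_jap v
  have hJw := one_le_jap w
  have hg := g0_nonneg e (r⁻¹ • (v - w))
  have hre := Real.rpow_nonneg hr.le e
  rcases lt_or_ge ‖v - w‖ r with h | h
  · left
    rw [near_eq e _ r hr h]
    have : r ^ e * g0 e (r⁻¹ • (v - w)) * φ ≤ r ^ e * g0 e (r⁻¹ • (v - w)) * G := by gcongr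
    have h2 : 0 ≤ r ^ e * 2 ^ p * jap v ^ (-p) * (jap w ^ p * φ) := by positivity
    linarith
  · rcases le_or_gt ‖v - w‖ (jap v / 2) with h2 | h2
    · left
      have h3 : ‖v - w‖ ^ e ≤ r ^ e := Real.rpow_le_rpow_of_nonpos hr h he0
      have h4 : jap v ≤ 2 * jap w := by linarith [jap_le v w]
      have h5 : jap v ^ p ≤ 2 ^ p * jap w ^ p := by
        rw [← Real.mul_rpow (by norm_num) (by linarith)]
        exact Real.rpow_le_rpow (by linarith) h4 hp
      have h6 : 1 ≤ 2 ^ p * jap v ^ (-p) * jap w ^ p := by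
        rw [Real.rpow_neg (by linarith)]
        have : 0 < jap v ^ p := by positivity
        field_simp
        exact h5
      have h7 : 0 ≤ G * r ^ e * g0 e (r⁻¹ • (v - w)) := by
        have : 0 ≤ G := hφ.trans hφG
        positivity
      calc ‖v - w‖ ^ e * φ ≤ r ^ e * φ * 1 := by rw [mul_one]; gcongr
        _ ≤ r ^ e * φ * (2 ^ p * jap v ^ (-p) * jap w ^ p) := by gcongr
        _ ≤ _ := by linarith
    · right
      calc ‖v - w‖ ^ e ≤ (jap v / 2) ^ e :=
            Real.rpow_le_rpow_of_nonpos (by linarith) h2.le he0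
        _ = (2 : ℝ) ^ (-e) * jap v ^ e := by
            rw [Real.div_rpow (by linarith) (by norm_num), Real.rpow_neg (by norm_num)]
            field_simp
        _ ≤ 2 * jap v ^ e := by
            gcongr
            calc (2 : ℝ) ^ (-e) ≤ 2 ^ (1 : ℝ) :=
                  Real.rpow_le_rpow_of_exponent_le (by norm_num) (by linarith)
              _ = 2 := by norm_num

lemma proj_abs_le (z : V3) (i j : Fin 3) : |proj z i j| ≤ 2 := by
  have h : ∀ k, |z k / ‖z‖| ≤ 1 := fun k => by
    rw [abs_div, abs_norm]
    exact div_le_one_of_le₀ (PiLp.norm_apply_le z k) (norm_nonneg _)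
  have h1 : |z i / ‖z‖ * (z j / ‖z‖)| ≤ 1 := by
    rw [abs_mul]; exact mul_le_one₀ (h i) (abs_nonneg _) (h j)
  unfold proj
  rw [abs_le] at *
  split_ifs <;> constructor <;> linarith [h1.1, h1.2]

lemma kernel_integrable (γ G : ℝ) (hγ : γ ∈ Set.Icc (-3 : ℝ) (-2)) (f : V3 → ℝ)
    (hf : ∀ v, 0 ≤ f v) (hi : Integrable f) (hG : ∀ v, f v ≤ G) (v : V3) (i j : Fin 3) :
    Integrable (fun w => landauKernel γ (v - w) i j * f w) := by
  have hmeas : Measurable (fun z : V3 => landauKernel γ z i j) := by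
    unfold landauKernel proj
    have h1 : ∀ k, Measurable (fun z : V3 => z k) := fun k => by fun_prop
    exact (measurable_norm.pow_const _).mul
      (measurable_const.sub (((h1 i).div measurable_norm).mul ((h1 j).div measurable_norm)))
  have hb : Integrable (fun w => 2 * (G * g0 (γ + 2) ((1 : ℝ)⁻¹ • (v - w)) + f w)) :=
    (((near_integrable (γ + 2) (by linarith [hγ.1]) v 1 one_pos).const_mul G).add hi).const_mul 2
  refine hb.mono' ((hmeas.comp (measurable_const.sub measurable_id)).aestronglyMeasurable.mul
    hi.aestronglyMeasurable) (Filter.Eventually.of_forall fun w => ?_)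
  have hn := Real.rpow_nonneg (norm_nonneg (v - w)) (γ + 2)
  have hg := g0_nonneg (γ + 2) ((1 : ℝ)⁻¹ • (v - w))
  have hG0 : 0 ≤ G := (hf w).trans (hG w)
  have hfw := hf w
  have key : ‖v - w‖ ^ (γ + 2) * f w ≤ G * g0 (γ + 2) ((1 : ℝ)⁻¹ • (v - w)) + f w := by
    rcases lt_or_ge ‖v - w‖ 1 with h | h
    · rw [near_eq (γ + 2) _ 1 one_pos h, Real.one_rpow, one_mul]
      nlinarith [mul_le_mul_of_nonneg_left (hG w) hg]
    · have : ‖v - w‖ ^ (γ + 2) ≤ 1 :=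
        Real.rpow_le_one_of_one_le_of_nonpos h (by linarith [hγ.2])
      nlinarith [mul_nonneg hG0 hg]
  rw [Real.norm_eq_abs, abs_mul, abs_of_nonneg hfw]
  unfold landauKernel
  rw [abs_mul, abs_of_nonneg hn]
  calc ‖v - w‖ ^ (γ + 2) * |proj (v - w) i j| * f w
      ≤ ‖v - w‖ ^ (γ + 2) * 2 * f w := by gcongr; exact proj_abs_le _ _ _
    _ ≤ _ := by linarith

lemma quad_abar (γ : ℝ) (f : V3 → ℝ) (v ξ : V3)
    (h : ∀ i j, Integrable (fun w => landauKernel γ (v - w) i j * f w)) :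
    Integrable (fun w => quadForm (landauKernel γ (v - w)) ξ * f w) ∧
    quadForm (abar γ f v) ξ = ∫ w, quadForm (landauKernel γ (v - w)) ξ * f w := by
  have e : (fun w => quadForm (landauKernel γ (v - w)) ξ * f w) =
      fun w => ∑ i, ∑ j, (landauKernel γ (v - w) i j * f w) * (ξ i * ξ j) := by
    funext w
    simp only [quadForm, bilin, Finset.sum_mul]
    refine Finset.sum_congr rfl fun i _ => Finset.sum_congr rfl fun j _ => ?_
    ring
  rw [e]
  have h1 : ∀ i j, Integrable (fun w => (landauKernel γ (v - w) i j * f w) * (ξ i * ξ j)) :=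
    fun i j => (h i j).mul_const _
  have h2 : ∀ i, Integrable (fun w => ∑ j, (landauKernel γ (v - w) i j * f w) * (ξ i * ξ j)) :=
    fun i => integrable_finsetSum _ fun j _ => h1 i j
  refine ⟨integrable_finsetSum _ fun i _ => h2 i, ?_⟩
  rw [integral_finsetSum _ fun i _ => h2 i]
  simp only [quadForm, bilin]
  refine Finset.sum_congr rfl fun i _ => ?_
  rw [integral_finsetSum _ fun j _ => h1 i j]
  refine Finset.sum_congr rfl fun j _ => ?_
  rw [integral_mul_const]
  simp only [abar]
  ring

/-- integrated bound -/
lemma int_bound (q F N m t : V3 → ℝ) (A B C : ℝ) (hq : Integrable q) (hN : Integrable N)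
    (hm : Integrable m) (ht : Integrable t)
    (h : ∀ w, q w ≤ A * N w + B * m w + C * t w) :
    ∫ w, q w ≤ A * (∫ w, N w) + B * (∫ w, m w) + C * ∫ w, t w := by
  have h1 : Integrable (fun w => A * N w + B * m w) := (hN.const_mul A).add (hm.const_mul B)
  have h2 : Integrable (fun w => A * N w + B * m w + C * t w) := h1.add (ht.const_mul C)
  rw [← integral_const_mul, ← integral_const_mul, ← integral_const_mul,
    ← integral_add (hN.const_mul A) (hm.const_mul B), ← integral_add h1 (ht.const_mul C)]
  exact integral_mono hq h2 h

/-- ellipticity estimate from above for ā = a ⋆ f, with the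
anisotropic improvement in directions parallel to v (Lemma 8 of the paper). -/
theorem abar_ellipticity_upper (γ : ℝ) (hγ : γ ∈ Set.Icc (-3 : ℝ) (-2))
    (G M : ℝ) (hG : 0 < G) (hM : 0 < M) :
    ∃ Lam : ℝ, 0 < Lam ∧
      ∀ f : V3 → ℝ, (∀ v, 0 ≤ f v) → Integrable f → (∫ v, f v) = 1 →
        (∀ v, f v ≤ G) →
        Integrable (fun v => jap v ^ (γ * (γ + 2) / (γ + 5) - γ) * f v) →
        (∫ v, jap v ^ (γ * (γ + 2) / (γ + 5) - γ) * f v) ≤ M →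
        ∀ (v ξ : V3), ‖ξ‖ = 1 →
          quadForm (abar γ f v) ξ ≤ Lam * jap v ^ (γ + 2) ∧
          ((∃ c : ℝ, v = c • ξ) → quadForm (abar γ f v) ξ ≤ Lam * jap v ^ γ) := by
  obtain ⟨hγ1, hγ2⟩ := hγ
  have h5 : 0 < γ + 5 := by linarith
  set p : ℝ := γ * (γ + 2) / (γ + 5) - γ with hp
  have hp3 : p * (γ + 5) = -3 * γ := by rw [hp]; field_simp; ring
  have hp2 : 2 ≤ p := by nlinarith
  set K : ℝ := ∫ z, g0 (γ + 2) z with hK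
  have hK0 : 0 ≤ K := integral_nonneg (g0_nonneg _)
  refine ⟨G * K + 2 ^ p * M + 2 + 2 * M, by positivity, ?_⟩
  intro f hf hi hmass hfG hmi hmM v ξ hξ
  have hJ := one_le_jap v
  have hJ0 : 0 < jap v := by linarith
  set r : ℝ := jap v ^ (-p / 3) with hr
  have hr0 : 0 < r := Real.rpow_pos_of_pos hJ0 _
  have hNint := near_integrable (γ + 2) (by linarith) v r hr0
  obtain ⟨hqi, hqe⟩ := quad_abar γ f v ξ
    (fun i j => kernel_integrable γ G ⟨hγ1, hγ2⟩ f hf hi hfG v i j)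
  have hr1 : r ^ (γ + 2) * r ^ 3 = jap v ^ γ := by
    rw [← Real.rpow_natCast r 3, ← Real.rpow_add hr0, hr, ← Real.rpow_mul hJ0.le]
    congr 1
    push_cast
    linarith
  have hr2 : r ^ (γ + 2) * jap v ^ (-p) = jap v ^ γ := by
    rw [hr, ← Real.rpow_mul hJ0.le, ← Real.rpow_add hJ0]
    congr 1
    linarith
  have hJγ : 0 < jap v ^ γ := Real.rpow_pos_of_pos hJ0 _
  have hJle : jap v ^ γ ≤ jap v ^ (γ + 2) :=
    Real.rpow_le_rpow_of_exponent_le hJ (by linarith)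
  have hsplit : jap v ^ (γ + 2) = jap v ^ γ * jap v ^ 2 := by
    rw [Real.rpow_add hJ0]; norm_num
  have hq1 : ∀ w, quadForm (landauKernel γ (v - w)) ξ ≤ ‖v - w‖ ^ (γ + 2) := fun w => by
    simpa [hξ] using quad_landau_le γ (v - w) ξ
  have first : G * r ^ (γ + 2) * (∫ w, g0 (γ + 2) (r⁻¹ • (v - w))) = G * K * jap v ^ γ := by
    rw [near_integral _ _ _ hr0, ← hr1]; ring
  have second : r ^ (γ + 2) * 2 ^ p * jap v ^ (-p) * (∫ w, jap w ^ p * f w)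
      ≤ 2 ^ p * M * jap v ^ γ := by
    have : r ^ (γ + 2) * 2 ^ p * jap v ^ (-p) = 2 ^ p * jap v ^ γ := by rw [← hr2]; ring
    rw [this]
    nlinarith [mul_le_mul_of_nonneg_left hmM (by positivity : 0 ≤ (2 : ℝ) ^ p * jap v ^ γ)]
  have hfirst0 : ∀ w, 0 ≤ G * r ^ (γ + 2) * g0 (γ + 2) (r⁻¹ • (v - w))
      + r ^ (γ + 2) * 2 ^ p * jap v ^ (-p) * (jap w ^ p * f w) := fun w => by
    have := g0_nonneg (γ + 2) (r⁻¹ • (v - w))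
    have := hf w
    have := one_le_jap w
    positivity
  have hpb := fun w => pow_bound (γ + 2) p G (by linarith) (by linarith) (by linarith) v w (f w)
    (hf w) (hfG w) r hr0
  have hGK : 0 ≤ G * K := by positivity
  have hPM : 0 ≤ 2 ^ p * M := by positivity
  constructor
  · rw [hqe]
    refine (int_bound _ f _ _ f (G * r ^ (γ + 2)) (r ^ (γ + 2) * 2 ^ p * jap v ^ (-p))
      (2 * jap v ^ (γ + 2)) hqi hNint hmi hi fun w => ?_).trans ?_
    · have h1 := mul_le_mul_of_nonneg_right (hq1 w) (hf w)
      rcases hpb w with h | h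
      · have : 0 ≤ 2 * jap v ^ (γ + 2) * f w := by have := hf w; positivity
        linarith
      · have := mul_le_mul_of_nonneg_right h (hf w)
        linarith [hfirst0 w]
    · rw [first, hmass]
      have := mul_le_mul_of_nonneg_left hJle (add_nonneg hGK hPM)
      have : 0 ≤ M * jap v ^ (γ + 2) := by positivity
      linarith
  · rintro ⟨c, hc⟩
    rw [hqe]
    refine (int_bound _ f _ _ _ (G * r ^ (γ + 2)) (r ^ (γ + 2) * 2 ^ p * jap v ^ (-p))
      (2 * jap v ^ γ) hqi hNint hmi hmi fun w => ?_).trans ?_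
    · have hJw := one_le_jap w
      have h1 := mul_le_mul_of_nonneg_right (hq1 w) (hf w)
      rcases hpb w with h | h
      · have : 0 ≤ 2 * jap v ^ γ * (jap w ^ p * f w) := by have := hf w; positivity
        linarith
      · have h2 : ‖v‖ ^ 2 * quadForm (landauKernel γ (v - w)) ξ
            ≤ ‖v - w‖ ^ (γ + 2) * ‖w‖ ^ 2 := by
          have := quad_landau_shift γ (v - w) w
          rw [sub_add_cancel] at this
          have hcn : ‖v‖ ^ 2 = c ^ 2 := by rw [hc, norm_smul, hξ]; simp
          rw [hcn, ← quad_smul, ← hc]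
          exact this
        have h3 : jap v ^ 2 * quadForm (landauKernel γ (v - w)) ξ
            ≤ ‖v - w‖ ^ (γ + 2) * jap w ^ 2 := by
          rw [jap_sq, jap_sq]; linarith [hq1 w]
        have h4 : jap w ^ 2 ≤ jap w ^ p := by
          rw [← Real.rpow_natCast]
          exact Real.rpow_le_rpow_of_exponent_le hJw (by simpa using hp2)
        have h5 : jap v ^ 2 * quadForm (landauKernel γ (v - w)) ξ
            ≤ jap v ^ 2 * (2 * jap v ^ γ * jap w ^ p) := by
          calc _ ≤ _ := h3
            _ ≤ (2 * jap v ^ (γ + 2)) * jap w ^ p := by gcongr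
            _ = _ := by rw [hsplit]; ring
        have h6 := le_of_mul_le_mul_left h5 (by positivity)
        have := mul_le_mul_of_nonneg_right h6 (hf w)
        linarith [hfirst0 w]
    · rw [first]
      have := mul_le_mul_of_nonneg_left hmM hJγ.le
      linarith

end
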